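/- Let s ≥ 1 and n ≥ 2s, and let θ⁺ ∈ ℂ^s have nonzero pairwise-distinct entries. Then for almost every z ∈ ℂ^{3s} (with respect to Lebesgue measure on ℂ^{3s} ≅ ℝ^{6s}), the 3s × s matrix V_n(z)^T V_n(θ⁺) has trivial kernel; consequently, for any g⁺ ∈ ℂ^s, the unique g ∈ ℂ^s satisfying V_n(z)^T V_n(θ⁺) g = V_n(z)^T V_n(θ⁺) g⁺ is g = g⁺. -/

import Mathlib

open Matrix MeasureTheory

/-- The `n × k` Vandermonde matrix with `(j,l)` entry `w_l^j`. -/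
noncomputable def vand (n k : ℕ) (w : Fin k → ℂ) : Matrix (Fin n) (Fin k) ℂ :=
  Matrix.of fun j l => w l ^ (j : ℕ)

/-- Linearly independent polynomials have nonsingular evaluation matrices at almost every tuple of
points. -/
theorem ae_det_eval_ne_zero_of_linearIndependent (m : ℕ) :
    ∀ (s : ℕ) (h : s ≤ m) (p : Fin s → Polynomial ℂ), LinearIndependent ℂ p →
      ∀ᵐ z : Fin m → ℂ ∂volume,
        (Matrix.of fun k l => (p l).eval (z (Fin.castLE h k))).det ≠ 0 := by
  induction m with
  | zero =>
    intro s h p _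
    obtain rfl : s = 0 := by omega
    simp
  | succ m ih =>
    intro s h p hp
    cases s with
    | zero => simp
    | succ s =>
      have hs : s ≤ m := by omega
      set D : ℂ → (Fin m → ℂ) → ℂ := fun x y =>
        (Matrix.of fun k l => (p l).eval (Fin.cons (α := fun _ => ℂ) x y (Fin.castLE h k))).det
        with hD
      have hcont : Continuous fun q : ℂ × (Fin m → ℂ) => D q.1 q.2 := by
        refine Continuous.matrix_det (continuous_matrix fun k l => ?_)
        refine (p l).continuous.comp ?_
        refine Fin.cases ?_ (fun k => ?_) k
        · exact continuous_fst
        · exact (continuous_apply (Fin.castLE hs k)).comp continuous_snd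
      have hmeas : MeasurableSet {q : ℂ × (Fin m → ℂ) | D q.1 q.2 ≠ 0} :=
        (isOpen_ne_fun hcont continuous_const).measurableSet
      have hfiber : ∀ᵐ y : Fin m → ℂ ∂volume, ∀ᵐ x : ℂ ∂volume, D x y ≠ 0 := by
        have hp' : LinearIndependent ℂ fun l : Fin s => p l.succ :=
          hp.comp _ (Fin.succ_injective s)
        filter_upwards [ih s hs _ hp'] with y hy
        let c : Fin (s + 1) → ℂ := fun l => (-1) ^ (l : ℕ) *
          (Matrix.of fun k i : Fin s => (p (l.succAbove i)).eval (y (Fin.castLE hs k))).det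
        have hDc : ∀ x, D x y = (∑ l, c l • p l).eval x := by
          intro x
          simp only [hD]
          rw [Matrix.det_succ_row_zero, Polynomial.eval_finsetSum]
          refine Finset.sum_congr rfl fun l _ => ?_
          rw [Polynomial.eval_smul, smul_eq_mul, mul_right_comm]
          rfl
        have hne : ∑ l, c l • p l ≠ 0 := fun h0 => hy <| by
          simpa [c] using Fintype.linearIndependent_iff.1 hp c h0 0
        have hfin : {x | (∑ l, c l • p l).IsRoot x}.Finite := Polynomial.finite_setOfPred_isRoot hne
        filter_upwards [hfin.countable.ae_notMem volume] with x hx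
        rw [hDc]
        exact hx
      have hprod : ∀ᵐ q : ℂ × (Fin m → ℂ) ∂(volume.prod volume), D q.1 q.2 ≠ 0 :=
        (Measure.ae_prod_iff_ae_ae hmeas).2 ((Measure.ae_ae_comm hmeas).2 hfiber)
      have hpres := volume_preserving_piFinSuccAbove (fun _ : Fin (m + 1) => ℂ) 0
      filter_upwards [hpres.quasiMeasurePreserving.ae hprod] with z hz
      have hcons : Fin.cons (z 0) (fun i : Fin m => z i.succ) = z := Fin.cons_self_tail z
      change D (z 0) (fun i => z i.succ) ≠ 0 at hz
      simpa only [hD, hcons] using hz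

/-- The truncated geometric polynomials `∑ j < n, a ^ j X ^ j` of at most `n` distinct ratios `a`
are linearly independent. -/
theorem linearIndependent_sum_monomial_pow {K : Type*} [Field K] {s n : ℕ} (h : s ≤ n)
    {a : Fin s → K} (ha : Function.Injective a) :
    LinearIndependent K fun l => ∑ j : Fin n, Polynomial.monomial (j : ℕ) (a l ^ (j : ℕ)) := by
  rw [Fintype.linearIndependent_iff]
  intro g hg
  refine fun i => congrFun (Matrix.eq_zero_of_forall_pow_sum_mul_pow_eq_zero ha fun j => ?_) i
  have hj := congrArg (fun q => Polynomial.coeff q (j : ℕ)) hg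
  simp only [Polynomial.finsetSum_coeff, Polynomial.coeff_smul, Polynomial.coeff_monomial,
    Polynomial.coeff_zero, smul_eq_mul] at hj
  rw [← hj]
  refine Finset.sum_congr rfl fun l _ => ?_
  rw [Finset.sum_eq_single (Fin.castLE h j)]
  · simp
  · intro b _ hb
    rw [if_neg]
    exact fun hbj => hb (Fin.ext hbj)
  · simp

/-- for almost every `z ∈ ℂ^{3s}` (Lebesgue measure), the `3s × s` matrix
`V_n(z)^T V_n(θ⁺)` has trivial kernel; hence `g` is uniquely determined by the measurements. -/
theorem ae_vandermonde_product_trivial_kernel (s n : ℕ) (hs : 1 ≤ s) (hn : 2 * s ≤ n)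
    (θp : Fin s → ℂ) (hθ0 : ∀ l, θp l ≠ 0) (hθinj : Function.Injective θp) :
    ∀ᵐ z : Fin (3 * s) → ℂ ∂volume,
      (∀ g : Fin s → ℂ,
          ((vand n (3 * s) z).transpose * vand n s θp).mulVec g = 0 → g = 0) ∧
      (∀ gp g : Fin s → ℂ,
          ((vand n (3 * s) z).transpose * vand n s θp).mulVec g =
            ((vand n (3 * s) z).transpose * vand n s θp).mulVec gp → g = gp) := by
  have hker : ∀ᵐ z : Fin (3 * s) → ℂ ∂volume, ∀ g : Fin s → ℂ,
      ((vand n (3 * s) z).transpose * vand n s θp).mulVec g = 0 → g = 0 := by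
    have hsm : s ≤ 3 * s := by omega
    filter_upwards [ae_det_eval_ne_zero_of_linearIndependent (3 * s) s hsm _
      (linearIndependent_sum_monomial_pow (by omega : s ≤ n) hθinj)] with z hz g hg
    refine Matrix.eq_zero_of_mulVec_eq_zero hz (funext fun k => ?_)
    refine Eq.trans ?_ (congrFun hg (Fin.castLE hsm k))
    simp [Matrix.mulVec, dotProduct, Matrix.mul_apply, vand, Polynomial.eval_finsetSum, mul_comm]
  filter_upwards [hker] with z hz
  refine ⟨hz, fun gp g hg => sub_eq_zero.1 (hz _ ?_)⟩
  rw [Matrix.mulVec_sub, hg, sub_self]
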